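/- Let E : ℕ → ℝ be a nondecreasing sequence with E 0 = 0 and E i ≥ 0 satisfying the Gibbs condition, and let F_E be the associated maximal-entropy function. Then for every t > 0 and every ε ∈ (0,1) there exist probability distributions p and q on ℕ such that ∑_i (E i)·(p i) ≤ t, TV(p,q) ≤ ε, and H(p) − H(q) > ε·F_E(t/ε). Consequently, the continuity bound H(p) − H(q) ≤ ε·F_E(t/ε) + g(ε) cannot be improved by more than the additive term g(ε). -/

import Mathlib

open scoped ENNReal

/-- `p` is a probability distribution on `α`: nonnegative entries summing to `1`. -/
def IsProbDist {α : Type*} (p : α → ℝ) : Prop := (∀ x, 0 ≤ p x) ∧ HasSum p 1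

/-- Extended-real-valued Shannon entropy `H(r) = ∑ η(r i) ∈ [0,+∞]`,
where `η(x) = −x ln x`. -/
noncomputable def shEnt (r : ℕ → ℝ) : ℝ≥0∞ :=
  ∑' i, ENNReal.ofReal (Real.negMulLog (r i))

/-- Total variation distance `TV(p,q) = (1/2)·∑ |p x − q x|`. -/
noncomputable def TVd {α : Type*} (p q : α → ℝ) : ℝ := (1 / 2) * ∑' x, |p x - q x|

/-- `g(x) = (x+1)·ln(x+1) − x·ln x` (with `g(0) = 0`, as `Real.log 0 = 0`). -/
noncomputable def gFun (x : ℝ) : ℝ := (x + 1) * Real.log (x + 1) - x * Real.log x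

/-- Binary entropy `h₂(x) = η(x) + η(1−x)`. -/
noncomputable def h2 (x : ℝ) : ℝ := Real.negMulLog x + Real.negMulLog (1 - x)

/-- The Gibbs condition: `∑_i exp(−β·E i) < ∞` for every `β > 0`. -/
def GibbsCond (E : ℕ → ℝ) : Prop :=
  ∀ β : ℝ, 0 < β → Summable fun i => Real.exp (-β * E i)

/-- The mean energy `∑_i E i · p i ∈ [0,+∞]` (the terms being nonnegative for
probability distributions and nonnegative `E`). -/
noncomputable def meanE (E : ℕ → ℝ) (p : ℕ → ℝ) : ℝ≥0∞ :=
  ∑' i, ENNReal.ofReal (E i * p i)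

/-- The maximal-entropy function
`F_E(t) = sup{ H(p) : p prob. distribution on ℕ, ∑ E i · p i ≤ t }`. -/
noncomputable def FE (E : ℕ → ℝ) (t : ℝ) : ℝ :=
  sSup {h : ℝ | ∃ p : ℕ → ℝ, IsProbDist p ∧ meanE E p ≤ ENNReal.ofReal t ∧
    h = (shEnt p).toReal}

/-- Young's inequality for the entropy function: `η` lies below its tangent lines. -/
lemma negMulLog_le_mul_add_exp {x : ℝ} (hx : 0 ≤ x) (a : ℝ) :
    Real.negMulLog x ≤ a * x + Real.exp (-a - 1) := by
  rcases hx.eq_or_lt with rfl | hx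
  · simpa using (Real.exp_pos _).le
  · have h := Real.log_le_sub_one_of_pos (div_pos (Real.exp_pos (-a - 1)) hx)
    rw [Real.log_div (Real.exp_pos _).ne' hx.ne', Real.log_exp] at h
    have h' := mul_le_mul_of_nonneg_left h hx.le
    have e : x * (Real.exp (-a - 1) / x - 1) = Real.exp (-a - 1) - x := by field_simp
    rw [e] at h'
    rw [Real.negMulLog]
    linarith

lemma negMulLog_le_one_sub {x : ℝ} (hx : 0 ≤ x) : Real.negMulLog x ≤ 1 - x := by
  have h := negMulLog_le_mul_add_exp hx (-1)
  norm_num at h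
  linarith

lemma IsProbDist.le_one {α : Type*} {p : α → ℝ} (hp : IsProbDist p) (i : α) : p i ≤ 1 :=
  le_hasSum hp.2 i fun j _ => hp.1 j

lemma isProbDist_single {α : Type*} [DecidableEq α] (a : α) :
    IsProbDist (Pi.single a (1 : ℝ)) := by
  refine ⟨fun x => ?_, hasSum_pi_single a 1⟩
  by_cases h : x = a
  · subst h; simp
  · simp [h]

/-- Convex combinations of probability distributions. -/
lemma IsProbDist.mix {α : Type*} {p q : α → ℝ} (hp : IsProbDist p) (hq : IsProbDist q)
    {ε : ℝ} (h0 : 0 ≤ ε) (h1 : ε ≤ 1) :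
    IsProbDist fun i => ε * p i + (1 - ε) * q i := by
  refine ⟨fun i => ?_, ?_⟩
  · have := hp.1 i
    have := hq.1 i
    have := sub_nonneg.2 h1
    positivity
  · simpa using (hp.2.mul_left ε).add (hq.2.mul_left (1 - ε))

lemma shEnt_single : shEnt (Pi.single 0 1) = 0 := by
  rw [shEnt, ENNReal.tsum_eq_zero]
  intro i
  by_cases h : i = 0
  · subst h; simp
  · simp [h]

lemma TVd_mix_le {p q : ℕ → ℝ} (hp : IsProbDist p) (hq : IsProbDist q) {ε : ℝ} (h0 : 0 ≤ ε) :
    TVd (fun i => ε * p i + (1 - ε) * q i) q ≤ ε := by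
  have hs := (hp.2.add hq.2).mul_left ε
  have hle : ∀ i, |ε * p i + (1 - ε) * q i - q i| ≤ ε * (p i + q i) := fun i => by
    have e : ε * p i + (1 - ε) * q i - q i = ε * (p i - q i) := by ring
    rw [e, abs_mul, abs_of_nonneg h0]
    gcongr
    rw [abs_le]
    constructor <;> linarith [hp.1 i, hq.1 i]
  have hsum := Summable.of_nonneg_of_le (fun _ => abs_nonneg _) hle hs.summable
  have := hasSum_le hle hsum.hasSum hs
  rw [TVd]
  linarith

lemma meanE_mix_single {E p : ℕ → ℝ} (hE0 : E 0 = 0) {ε : ℝ} (h0 : 0 ≤ ε) :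
    meanE E (fun i => ε * p i + (1 - ε) * (Pi.single 0 1 : ℕ → ℝ) i) =
      ENNReal.ofReal ε * meanE E p := by
  rw [meanE, meanE, ← ENNReal.tsum_mul_left]
  refine tsum_congr fun i => ?_
  rw [← ENNReal.ofReal_mul h0]
  congr 1
  by_cases h : i = 0
  · subst h; simp [hE0]
  · simp [h]; ring

lemma meanE_mix_single_le {E p : ℕ → ℝ} (hE0 : E 0 = 0) {ε t : ℝ} (h0 : 0 < ε)
    (h : meanE E p ≤ ENNReal.ofReal (t / ε)) :
    meanE E (fun i => ε * p i + (1 - ε) * (Pi.single 0 1 : ℕ → ℝ) i) ≤ ENNReal.ofReal t := by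
  rw [meanE_mix_single hE0 h0.le]
  calc _ ≤ ENNReal.ofReal ε * ENNReal.ofReal (t / ε) := by gcongr
    _ = ENNReal.ofReal t := by rw [← ENNReal.ofReal_mul h0.le, mul_div_cancel₀ _ h0.ne']

/-- The entropy of a distribution of bounded mean energy is finite, and small when the
distribution is concentrated at `0`. -/
lemma entropy_le_of_meanE_le {E : ℕ → ℝ} (hE0 : E 0 = 0) (hEnn : ∀ i, 0 ≤ E i)
    (hGibbs : GibbsCond E) {s : ℝ} (hs : 0 ≤ s) {p : ℕ → ℝ} (hp : IsProbDist p)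
    (hpE : meanE E p ≤ ENNReal.ofReal s) {β : ℝ} (hβ : 0 < β) (K : ℝ) :
    Summable (fun i => Real.negMulLog (p i)) ∧
      ∑' i, Real.negMulLog (p i) ≤
        β * s + Real.exp (-K - 1) * ∑' i, Real.exp (-β * E i) + (1 + K) * (1 - p 0) := by
  have hnn : ∀ i, 0 ≤ E i * p i := fun i => mul_nonneg (hEnn i) (hp.1 i)
  have hEs : Summable fun i => E i * p i := by
    have h := ENNReal.summable_toReal (ne_top_of_le_ne_top ENNReal.ofReal_ne_top hpE)
    simpa only [ENNReal.toReal_ofReal (hnn _)] using h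
  have hEle : ∑' i, E i * p i ≤ s := by
    rw [meanE, ← ENNReal.ofReal_tsum_of_nonneg hnn hEs] at hpE
    exact (ENNReal.ofReal_le_ofReal_iff hs).1 hpE
  have hle : ∀ i, Real.negMulLog (p i) ≤
      β * (E i * p i) + Real.exp (-K - 1) * Real.exp (-β * E i) + K * p i
        + (Pi.single 0 (1 - p 0 - K * p 0) : ℕ → ℝ) i := by
    intro i
    by_cases h : i = 0
    · subst h
      have := negMulLog_le_one_sub (hp.1 0)
      have := Real.exp_pos (-K - 1)
      simp [hE0]
      linarith
    · have := negMulLog_le_mul_add_exp (hp.1 i) (β * E i + K)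
      have e : -(β * E i + K) - 1 = (-K - 1) + -β * E i := by ring
      rw [e, Real.exp_add] at this
      simp only [Pi.single_eq_of_ne h]
      linarith
  have hsum := (((hEs.hasSum.mul_left β).add
    ((hGibbs β hβ).hasSum.mul_left (Real.exp (-K - 1)))).add (hp.2.mul_left K)).add
      (hasSum_pi_single (0 : ℕ) (1 - p 0 - K * p 0))
  have hη := Summable.of_nonneg_of_le
    (fun i => Real.negMulLog_nonneg (hp.1 i) (hp.le_one i)) hle hsum.summable
  refine ⟨hη, ?_⟩
  have h1 := hasSum_le hle hη.hasSum hsum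
  have h2 := mul_le_mul_of_nonneg_left hEle hβ.le
  linarith

lemma toReal_shEnt {p : ℕ → ℝ} (hp : IsProbDist p)
    (h : Summable fun i => Real.negMulLog (p i)) :
    (shEnt p).toReal = ∑' i, Real.negMulLog (p i) := by
  have hnn := fun i => Real.negMulLog_nonneg (hp.1 i) (hp.le_one i)
  rw [shEnt, ← ENNReal.ofReal_tsum_of_nonneg hnn h, ENNReal.toReal_ofReal (tsum_nonneg hnn)]

lemma bddAbove_entropy {E : ℕ → ℝ} (hE0 : E 0 = 0) (hEnn : ∀ i, 0 ≤ E i)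
    (hGibbs : GibbsCond E) {s : ℝ} (hs : 0 ≤ s) :
    BddAbove {h : ℝ | ∃ p : ℕ → ℝ, IsProbDist p ∧ meanE E p ≤ ENNReal.ofReal s ∧
      h = (shEnt p).toReal} := by
  refine ⟨1 * s + Real.exp (-(-1) - 1) * ∑' i, Real.exp (-1 * E i), ?_⟩
  rintro _ ⟨p, hp, hpE, rfl⟩
  obtain ⟨h, hle⟩ := entropy_le_of_meanE_le hE0 hEnn hGibbs hs hp hpE one_pos (-1)
  rw [toReal_shEnt hp h]
  linarith

/-- Entropy of a mixture with the point mass at `0`. -/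
lemma le_shEnt_mix_single {p : ℕ → ℝ} (hp : IsProbDist p)
    (h : Summable fun i => Real.negMulLog (p i)) {ε : ℝ} (h0 : 0 ≤ ε) (h1 : ε ≤ 1) :
    ENNReal.ofReal (ε * ∑' i, Real.negMulLog (p i) + Real.negMulLog ε * (1 - p 0)) ≤
      shEnt (fun i => ε * p i + (1 - ε) * (Pi.single 0 1 : ℕ → ℝ) i) := by
  have hε := Real.negMulLog_nonneg h0 h1
  have hs := (h.hasSum.mul_left ε).add
    ((hp.2.sub (hasSum_pi_single (0 : ℕ) (p 0))).mul_left (Real.negMulLog ε))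
  have hnn : ∀ i, 0 ≤ ε * Real.negMulLog (p i) +
      Real.negMulLog ε * (p i - (Pi.single 0 (p 0) : ℕ → ℝ) i) := by
    intro i
    have := Real.negMulLog_nonneg (hp.1 i) (hp.le_one i)
    refine add_nonneg (mul_nonneg h0 this) (mul_nonneg hε ?_)
    by_cases hi : i = 0
    · subst hi; simp
    · simpa [hi] using hp.1 i
  rw [← hs.tsum_eq, ENNReal.ofReal_tsum_of_nonneg hnn hs.summable, shEnt]
  refine ENNReal.tsum_le_tsum fun i => ENNReal.ofReal_le_ofReal ?_
  by_cases hi : i = 0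
  · subst hi
    have := Real.concaveOn_negMulLog.2 (x := p 0) (y := 1) (hp.1 0) (Set.mem_Ici.2 zero_le_one)
      h0 (sub_nonneg.2 h1) (by ring)
    simpa using this
  · simp only [Pi.single_eq_of_ne hi, mul_zero, add_zero, sub_zero, Real.negMulLog_mul]
    linarith

lemma FE_pos {E : ℕ → ℝ} (hE0 : E 0 = 0) (hEnn : ∀ i, 0 ≤ E i)
    (hGibbs : GibbsCond E) {s : ℝ} (hs : 0 < s) : 0 < FE E s := by
  set u : ℝ := s / (s + E 1 + 1) with hu
  have hE1 := hEnn 1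
  have hd : 0 < s + E 1 + 1 := by positivity
  have hu0 : 0 < u := by positivity
  have hu1 : u < 1 := by rw [hu, div_lt_one hd]; linarith
  have huE : E 1 ≤ s / u := by
    have : s / u = s + E 1 + 1 := by rw [hu]; field_simp
    linarith
  have hδ : Summable fun i => Real.negMulLog ((Pi.single 1 1 : ℕ → ℝ) i) := by
    refine summable_of_ne_finset_zero (s := {1}) fun i hi => ?_
    simp [Pi.single_eq_of_ne (Finset.notMem_singleton.1 hi)]
  have hδ0 : 0 ≤ ∑' i, Real.negMulLog ((Pi.single 1 1 : ℕ → ℝ) i) :=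
    tsum_nonneg fun i => Real.negMulLog_nonneg ((isProbDist_single 1).1 i)
      ((isProbDist_single 1).le_one i)
  have hm : meanE E (Pi.single 1 1) ≤ ENNReal.ofReal (s / u) := by
    rw [meanE, tsum_eq_single 1 fun i hi => by simp [hi]]
    simpa using ENNReal.ofReal_le_ofReal huE
  have hp := (isProbDist_single 1).mix (isProbDist_single (0 : ℕ)) hu0.le hu1.le
  have hpE := meanE_mix_single_le hE0 hu0 hm
  have hle := le_shEnt_mix_single (isProbDist_single 1) hδ hu0.le hu1.le
  obtain ⟨hsum, -⟩ := entropy_le_of_meanE_le hE0 hEnn hGibbs hs.le hp hpE one_pos 0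
  have hfin : shEnt (fun i => u * (Pi.single 1 1 : ℕ → ℝ) i
      + (1 - u) * (Pi.single 0 1 : ℕ → ℝ) i) ≠ ⊤ := by
    rw [shEnt, ← ENNReal.ofReal_tsum_of_nonneg
      (fun i => Real.negMulLog_nonneg (hp.1 i) (hp.le_one i)) hsum]
    exact ENNReal.ofReal_ne_top
  have hηu : 0 < Real.negMulLog u := by
    have := mul_pos hu0 (neg_pos.2 (Real.log_neg hu0 hu1))
    rw [Real.negMulLog]
    linarith
  have hpos : 0 < u * ∑' i, Real.negMulLog ((Pi.single 1 1 : ℕ → ℝ) i)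
      + Real.negMulLog u * (1 - (Pi.single 1 1 : ℕ → ℝ) 0) := by
    simp only [Pi.single_eq_of_ne zero_ne_one, sub_zero, mul_one]
    positivity
  exact (ENNReal.toReal_pos ((ENNReal.ofReal_pos.2 hpos).trans_le hle).ne' hfin).trans_le
    (le_csSup (bddAbove_entropy hE0 hEnn hGibbs hs.le) ⟨_, hp, hpE, rfl⟩)

/-- Distributions of bounded mean energy with entropy bounded below are uniformly not
concentrated at `0`. -/
lemma exists_lt_one_sub_of_lt_entropy {E : ℕ → ℝ} (hE0 : E 0 = 0) (hEnn : ∀ i, 0 ≤ E i)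
    (hGibbs : GibbsCond E) {s : ℝ} (hs : 0 < s) {a : ℝ} (ha : 0 < a) :
    ∃ κ > 0, ∀ p : ℕ → ℝ, IsProbDist p → meanE E p ≤ ENNReal.ofReal s →
      a < ∑' i, Real.negMulLog (p i) → κ < 1 - p 0 := by
  have hβ : 0 < a / (3 * s) := by positivity
  set Z := ∑' i, Real.exp (-(a / (3 * s)) * E i) with hZ
  have hlim : Filter.Tendsto (fun K : ℝ => Real.exp (-K - 1) * Z) Filter.atTop (nhds 0) := by
    have h : Filter.Tendsto (fun K : ℝ => -K - 1) Filter.atTop Filter.atBot :=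
      Filter.tendsto_atBot_add_const_right _ _ Filter.tendsto_neg_atTop_atBot
    simpa using (Real.tendsto_exp_atBot.comp h).mul_const Z
  obtain ⟨K, hK, hK0⟩ := ((hlim.eventually_lt_const (show 0 < a / 3 by positivity)).and
    (Filter.eventually_ge_atTop 0)).exists
  refine ⟨a / (3 * (1 + K)), by positivity, fun p hp hpE hap => ?_⟩
  obtain ⟨-, hle⟩ := entropy_le_of_meanE_le hE0 hEnn hGibbs hs.le hp hpE hβ K
  have e : a / (3 * s) * s = a / 3 := by field_simp
  rw [e] at hle
  rw [div_lt_iff₀ (by positivity)]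
  linarith

/-- **Near-optimality of the entropy continuity bound**: for every `t > 0` and
`ε ∈ (0,1)` there exist probability distributions `p, q` on `ℕ` with
`∑ E i · p i ≤ t`, `TV(p,q) ≤ ε` and `H(p) − H(q) > ε·F_E(t/ε)`. -/
theorem entropy_energy_bound_near_optimal
    (E : ℕ → ℝ) (hmono : Monotone E) (hE0 : E 0 = 0) (hEnn : ∀ i, 0 ≤ E i)
    (hGibbs : GibbsCond E) (t : ℝ) (ht : 0 < t)
    (ε : ℝ) (hε0 : 0 < ε) (hε1 : ε < 1) :
    ∃ p q : ℕ → ℝ, IsProbDist p ∧ IsProbDist q ∧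
      meanE E p ≤ ENNReal.ofReal t ∧ TVd p q ≤ ε ∧
      ((ε * FE E (t / ε) : ℝ) : EReal) < (shEnt p : EReal) - (shEnt q : EReal) := by
  have hs : 0 < t / ε := by positivity
  have hF := FE_pos hE0 hEnn hGibbs hs
  set F := FE E (t / ε) with hFdef
  have hη : 0 < Real.negMulLog ε := by
    have := mul_pos hε0 (neg_pos.2 (Real.log_neg hε0 hε1))
    rw [Real.negMulLog]
    linarith
  obtain ⟨κ, hκ, hconc⟩ :=
    exists_lt_one_sub_of_lt_entropy hE0 hEnn hGibbs hs (half_pos hF)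
  have hlt : max (F / 2) (F - Real.negMulLog ε * κ / ε) < F :=
    max_lt (by linarith) (sub_lt_self _ (by positivity))
  have hne : {h : ℝ | ∃ p : ℕ → ℝ, IsProbDist p ∧ meanE E p ≤ ENNReal.ofReal (t / ε) ∧
      h = (shEnt p).toReal}.Nonempty := by
    by_contra hcon
    rw [hFdef, FE, Set.not_nonempty_iff_eq_empty.1 hcon, Real.sSup_empty] at hF
    exact hF.false
  obtain ⟨_, ⟨γ, hγ, hγE, rfl⟩, hγF⟩ := exists_lt_of_lt_csSup hne hlt
  obtain ⟨hsum, -⟩ := entropy_le_of_meanE_le hE0 hEnn hGibbs hs.le hγ hγE one_pos 0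
  rw [toReal_shEnt hγ hsum, max_lt_iff] at hγF
  have hκγ := hconc γ hγ hγE hγF.1
  have hbound : ε * F <
      ε * ∑' i, Real.negMulLog (γ i) + Real.negMulLog ε * (1 - γ 0) := by
    have h1 := mul_lt_mul_of_pos_left hγF.2 hε0
    have h2 := mul_lt_mul_of_pos_left hκγ hη
    have e : ε * (F - Real.negMulLog ε * κ / ε) = ε * F - Real.negMulLog ε * κ := by
      field_simp
    linarith
  refine ⟨_, Pi.single 0 1, hγ.mix (isProbDist_single 0) hε0.le hε1.le, isProbDist_single 0,
    meanE_mix_single_le hE0 hε0 hγE, TVd_mix_le hγ (isProbDist_single 0) hε0.le, ?_⟩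
  rw [shEnt_single, EReal.coe_ennreal_zero, sub_zero]
  refine lt_of_lt_of_le ?_
    (EReal.coe_ennreal_le_coe_ennreal_iff.2 (le_shEnt_mix_single hγ hsum hε0.le hε1.le))
  rw [EReal.coe_ennreal_ofReal]
  exact EReal.coe_lt_coe_iff.2 (lt_max_of_lt_left hbound)
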